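/- For the shear map f(x, y) = (x + y, y) on ℝ² with A the unit square, the transit components of the entry set I = {(x,y) : 0 ≤ x < y ≤ 1} are T_j = {(x,y) ∈ I : 1 − jy < x ≤ 1 − (j−1)y}, with Lebesgue measures μ(T₁) = 1/4 and μ(T_j) = 1/(j(j² − 1)) for j ≥ 2; moreover Σ_{j≥1} μ(T_j) = μ(I) = 1/2, Σ_{j≥1} j μ(T_j) = μ(A_acc), and Σ_{j≥1} j² μ(T_j) = ∞ (so the average transit time over A does not exist). -/

import Mathlib

open MeasureTheory ENNReal NNReal

/-- Forward exit time from `A` under `f`: the least `n ≥ 1` with `f^[n] a ∉ A`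
(`⊤` if no such `n` exists). For the backward exit time, apply this to the
inverse map `g` of `f`. -/
noncomputable def exitTime {M : Type*} (f : M → M) (A : Set M) (a : M) : ℕ∞ :=
  sInf ((fun n : ℕ => (n : ℕ∞)) '' {n : ℕ | 1 ≤ n ∧ f^[n] a ∉ A})

/-- The entry set `I = A \ f(A)`. -/
def entrySet {M : Type*} (f : M → M) (A : Set M) : Set M := A \ f '' A

/-- The transit-time component `T_j`: points of the entry set with exit time `j`. -/
noncomputable def transitComp {M : Type*} (f : M → M) (A : Set M) (j : ℕ) : Set M :=
  {a ∈ entrySet f A | exitTime f A a = (j : ℕ∞)}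

/-- The transit time `t_transit = t⁺ + t⁻ - 1`, where `g` is the inverse of `f`. -/
noncomputable def transitTime {M : Type*} (f g : M → M) (A : Set M) (a : M) : ℕ∞ :=
  exitTime f A a + exitTime g A a - 1

/-- The accessible set: points of `A` with finite backward exit time
(`g` is the inverse of `f`). -/
noncomputable def accSet {M : Type*} (g : M → M) (A : Set M) : Set M :=
  {a ∈ A | exitTime g A a ≠ ⊤}

theorem exitTime_eq_iff {M : Type*} (f : M → M) (A : Set M) (a : M) (j : ℕ) :
    exitTime f A a = (j : ℕ∞) ↔
      (1 ≤ j ∧ f^[j] a ∉ A) ∧ ∀ n : ℕ, 1 ≤ n → n < j → f^[n] a ∈ A := by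
  unfold exitTime
  constructor
  · intro h
    have hne : ((fun n : ℕ => (n : ℕ∞)) '' {n : ℕ | 1 ≤ n ∧ f^[n] a ∉ A}).Nonempty := by
      by_contra hh
      rw [Set.not_nonempty_iff_eq_empty] at hh
      rw [hh, _root_.sInf_empty] at h
      exact (ENat.coe_ne_top j) h.symm
    have hm := csInf_mem hne
    rw [h] at hm
    obtain ⟨m, hm, hmj⟩ := hm
    have : m = j := by
      have hmj : (m : ℕ∞) = (j : ℕ∞) := hmj
      exact_mod_cast hmj
    subst this
    refine ⟨hm, fun n hn hnm => ?_⟩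
    by_contra hc
    have : sInf ((fun n : ℕ => (n : ℕ∞)) '' {n : ℕ | 1 ≤ n ∧ f^[n] a ∉ A}) ≤ (n : ℕ∞) :=
      sInf_le ⟨n, ⟨hn, hc⟩, rfl⟩
    rw [h] at this
    have : m ≤ n := by exact_mod_cast this
    omega
  · rintro ⟨h1, h2⟩
    apply le_antisymm
    · exact sInf_le ⟨j, h1, rfl⟩
    · apply le_sInf
      rintro _ ⟨n, ⟨hn, hn2⟩, rfl⟩
      by_contra hc
      have hlt : n < j := by
        have : (n : ℕ∞) < (j : ℕ∞) := not_le.mp hc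
        exact_mod_cast this
      exact hn2 (h2 n hn hlt)

theorem exitTime_ne_top_iff {M : Type*} (f : M → M) (A : Set M) (a : M) :
    exitTime f A a ≠ ⊤ ↔ ∃ n : ℕ, 1 ≤ n ∧ f^[n] a ∉ A := by
  constructor
  · intro h
    by_contra! hc
    apply h
    unfold exitTime
    have : {n : ℕ | 1 ≤ n ∧ f^[n] a ∉ A} = ∅ := by
      ext n
      simp only [Set.mem_setOf_eq, Set.mem_empty_iff_false, iff_false, not_and, not_not]
      exact hc n
    rw [this, Set.image_empty, _root_.sInf_empty]
  · rintro ⟨n, hn⟩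
    have : exitTime f A a ≤ (n : ℕ∞) := sInf_le ⟨n, hn, rfl⟩
    exact ne_top_of_le_ne_top (ENat.coe_ne_top n) this

theorem shear_iter (n : ℕ) (p : ℝ × ℝ) :
    (fun p : ℝ × ℝ => (p.1 + p.2, p.2))^[n] p = (p.1 + n * p.2, p.2) := by
  induction n with
  | zero => simp
  | succ k ih =>
    rw [Function.iterate_succ_apply', ih]
    ext <;> simp
    ring

theorem shear_iter_inv (n : ℕ) (p : ℝ × ℝ) :
    (fun p : ℝ × ℝ => (p.1 - p.2, p.2))^[n] p = (p.1 - n * p.2, p.2) := by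
  induction n with
  | zero => simp
  | succ k ih =>
    rw [Function.iterate_succ_apply', ih]
    ext <;> simp
    ring

def tri (a b : ℝ) : Set (ℝ × ℝ) := {p | 0 ≤ p.1 ∧ p.1 < p.2 ∧ p.2 ≤ a - b * p.1}

theorem meas_tri (a b : ℝ) : MeasurableSet (tri a b) := by
  unfold tri
  apply MeasurableSet.inter (s₁ := {p : ℝ × ℝ | 0 ≤ p.1})
  · exact measurableSet_le measurable_const measurable_fst
  · apply MeasurableSet.inter (s₁ := {p : ℝ × ℝ | p.1 < p.2})
    · exact measurableSet_lt measurable_fst measurable_snd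
    · exact measurableSet_le measurable_snd (by fun_prop)

theorem vol_tri (a b : ℝ) (ha : 0 ≤ a) (hb : 0 ≤ b) :
    volume (tri a b) = ENNReal.ofReal (a ^ 2 / (2 * (1 + b))) := by
  rw [Measure.volume_eq_prod, Measure.prod_apply (meas_tri a b)]
  have h1 : ∀ x : ℝ, volume (Prod.mk x ⁻¹' tri a b) =
      (Set.Icc 0 (a / (1 + b))).indicator (fun x => ENNReal.ofReal (a - (1 + b) * x)) x := by
    intro x
    by_cases hx : 0 ≤ x
    · have : Prod.mk x ⁻¹' tri a b = Set.Ioc x (a - b * x) := by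
        ext y
        simp [tri, hx]
      rw [this, Real.volume_Ioc]
      by_cases hx2 : x ≤ a / (1 + b)
      · rw [Set.indicator_of_mem (show x ∈ Set.Icc 0 (a / (1 + b)) from ⟨hx, hx2⟩)]
        congr 1; ring
      · rw [Set.indicator_of_notMem (fun h => hx2 h.2)]
        rw [ENNReal.ofReal_eq_zero]
        rw [not_le, div_lt_iff₀ (by linarith)] at hx2
        linarith
    · rw [Set.indicator_of_notMem (fun h => hx h.1)]
      have : Prod.mk x ⁻¹' tri a b = ∅ := by
        ext y
        simp [tri, hx]
      rw [this, measure_empty]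
  simp_rw [h1]
  rw [lintegral_indicator measurableSet_Icc]
  have hc : 0 ≤ a / (1 + b) := by positivity
  rw [← ofReal_integral_eq_lintegral_ofReal]
  · rw [integral_Icc_eq_integral_Ioc, ← intervalIntegral.integral_of_le hc]
    congr 1
    rw [intervalIntegral.integral_sub (by simp) (by apply Continuous.intervalIntegrable; fun_prop),
      intervalIntegral.integral_const_mul, integral_id, intervalIntegral.integral_const]
    simp only [smul_eq_mul]
    field_simp
    ring
  · exact (Continuous.integrableOn_Icc (by fun_prop))
  · filter_upwards [ae_restrict_mem measurableSet_Icc] with x hx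
    have := hx.2
    rw [le_div_iff₀ (by linarith)] at this
    simp only [Pi.zero_apply]
    linarith

noncomputable def vv (j : ℕ) : ℝ := if j = 0 then 1 / 4 else 1 / (((j : ℝ) + 1) * (((j : ℝ) + 1) ^ 2 - 1))

theorem vv_succ (k : ℕ) : vv (k + 1) = 1 / (((k : ℝ) + 2) * ((k : ℝ) + 1) * ((k : ℝ) + 3)) := by
  unfold vv
  rw [if_neg (by omega)]
  push_cast
  congr 1
  ring

theorem vv_nonneg (k : ℕ) : 0 ≤ vv k := by
  cases k with
  | zero => simp [vv]
  | succ k => rw [vv_succ]; positivity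

theorem vv_sum0 : HasSum vv (1 / 2) := by
  rw [hasSum_iff_tendsto_nat_of_nonneg vv_nonneg, ← Filter.tendsto_add_atTop_iff_nat 1]
  have h : ∀ n : ℕ, ∑ i ∈ Finset.range (n + 1), vv i
      = 1 / 2 - (1 / 2) * (1 / ((n : ℝ) + 1) - 1 / (((n + 1 : ℕ) : ℝ) + 1)) := by
    intro n
    induction n with
    | zero => simp [vv]; norm_num
    | succ k ih =>
      rw [Finset.sum_range_succ, ih, vv_succ]
      push_cast
      field_simp
      ring
  simp_rw [h]
  have t := tendsto_one_div_add_atTop_nhds_zero_nat (𝕜 := ℝ)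
  have t1 := (Filter.tendsto_add_atTop_iff_nat 1).2 t
  have := ((t.sub t1).const_mul (1 / 2 : ℝ)).const_sub (1 / 2 : ℝ)
  rw [sub_zero, mul_zero, sub_zero] at this
  exact this

theorem vv_sum1 : HasSum (fun i : ℕ => ((i : ℝ) + 1) * vv i) 1 := by
  rw [hasSum_iff_tendsto_nat_of_nonneg (fun i => mul_nonneg (by positivity) (vv_nonneg i)),
    ← Filter.tendsto_add_atTop_iff_nat 1]
  have h : ∀ n : ℕ, ∑ i ∈ Finset.range (n + 1), ((i : ℝ) + 1) * vv i
      = 1 - (1 / 2) * (1 / ((n : ℝ) + 1) + 1 / (((n + 1 : ℕ) : ℝ) + 1)) := by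
    intro n
    induction n with
    | zero => simp [vv]; norm_num
    | succ k ih =>
      rw [Finset.sum_range_succ, ih, vv_succ]
      push_cast
      field_simp
      ring
  simp_rw [h]
  have t := tendsto_one_div_add_atTop_nhds_zero_nat (𝕜 := ℝ)
  have t1 := (Filter.tendsto_add_atTop_iff_nat 1).2 t
  have := ((t.add t1).const_mul (1 / 2 : ℝ)).const_sub (1 : ℝ)
  rw [add_zero, mul_zero, sub_zero] at this
  exact this

theorem vv_sum2 : ¬ Summable (fun i : ℕ => ((i : ℝ) + 1) ^ 2 * vv i) := by
  intro h
  have hs : Summable (fun i : ℕ => (1 / 4 : ℝ) * (1 / ((i + 1 : ℕ) : ℝ))) := by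
    refine Summable.of_nonneg_of_le (fun i => by positivity) (fun i => ?_) h
    cases i with
    | zero => simp [vv]
    | succ k =>
      rw [vv_succ]
      push_cast
      rw [← sub_nonneg]
      have : ((k : ℝ) + 1 + 1) ^ 2 * (1 / (((k : ℝ) + 2) * ((k : ℝ) + 1) * ((k : ℝ) + 3)))
          - 1 / 4 * (1 / ((k : ℝ) + 1 + 1))
          = (4 * ((k : ℝ) + 2) ^ 2 - ((k : ℝ) + 1) * ((k : ℝ) + 3))
            / (4 * ((k : ℝ) + 2) * ((k : ℝ) + 1) * ((k : ℝ) + 3)) := by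
        field_simp
        ring
      rw [this]
      apply div_nonneg _ (by positivity)
      nlinarith [(Nat.cast_nonneg k : (0 : ℝ) ≤ k)]
  have h2 : Summable (fun i : ℕ => 1 / ((i + 1 : ℕ) : ℝ)) := by
    have := hs.mul_left 4
    refine this.congr (fun i => by ring)
  exact Real.not_summable_one_div_natCast
    ((summable_nat_add_iff (f := fun i : ℕ => 1 / (i : ℝ)) 1).1 h2)

/-- The shear `f(x,y) = (x + y, y)` on the unit square: the entry set is the triangle
`{0 ≤ x < y ≤ 1}`, the transit components are `T_j = {(x,y) ∈ I : 1 - jy < x ≤ 1 - (j-1)y}`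
with `μ(T₁) = 1/4`, `μ(T_j) = 1/(j(j²-1))` for `j ≥ 2`; moreover `Σ μ(T_j) = μ(I) = 1/2`,
`Σ j μ(T_j) = μ(A_acc)`, and `Σ j² μ(T_j) = ∞`. -/
theorem shear_exit
    (f g : ℝ × ℝ → ℝ × ℝ)
    (hfdef : f = fun p => (p.1 + p.2, p.2)) (hgdef : g = fun p => (p.1 - p.2, p.2))
    (A : Set (ℝ × ℝ)) (hAdef : A = Set.Icc (0 : ℝ) 1 ×ˢ Set.Icc (0 : ℝ) 1) :
    entrySet f A = {p : ℝ × ℝ | 0 ≤ p.1 ∧ p.1 < p.2 ∧ p.2 ≤ 1} ∧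
    (∀ j : ℕ, 1 ≤ j →
      transitComp f A j
        = {p ∈ entrySet f A |
            1 - (j : ℝ) * p.2 < p.1 ∧ p.1 ≤ 1 - ((j : ℝ) - 1) * p.2}) ∧
    volume (transitComp f A 1) = ENNReal.ofReal (1 / 4) ∧
    (∀ j : ℕ, 2 ≤ j →
      volume (transitComp f A j)
        = ENNReal.ofReal (1 / ((j : ℝ) * ((j : ℝ) ^ 2 - 1)))) ∧
    (∑' j : ℕ, volume (transitComp f A (j + 1)) = volume (entrySet f A)) ∧
    volume (entrySet f A) = ENNReal.ofReal (1 / 2) ∧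
    (∑' j : ℕ, ((j + 1 : ℕ) : ℝ≥0∞) * volume (transitComp f A (j + 1))
      = volume (accSet g A)) ∧
    (∑' j : ℕ, (((j + 1) ^ 2 : ℕ) : ℝ≥0∞) * volume (transitComp f A (j + 1)) = ⊤) := by
  have hI : entrySet f A = {p : ℝ × ℝ | 0 ≤ p.1 ∧ p.1 < p.2 ∧ p.2 ≤ 1} := by
    subst hfdef hAdef
    ext ⟨x, y⟩
    simp only [entrySet, Set.mem_diff, Set.mem_image, Set.mem_prod, Set.mem_Icc, Set.mem_setOf_eq,
      Prod.exists, Prod.mk.injEq, not_exists, not_and]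
    constructor
    · rintro ⟨⟨⟨h1, h2⟩, h3, h4⟩, h5⟩
      refine ⟨h1, ?_, h4⟩
      by_contra hc
      exact h5 (x - y) y ⟨⟨by linarith, by linarith⟩, h3, h4⟩ (by ring) rfl
    · rintro ⟨h1, h2, h3⟩
      refine ⟨⟨⟨h1, by linarith⟩, by linarith, h3⟩, ?_⟩
      rintro a b ⟨⟨h4, h5⟩, h6, h7⟩ h8 h9
      linarith
  have hT : ∀ j : ℕ, 1 ≤ j →
      transitComp f A j
        = {p ∈ entrySet f A |
            1 - (j : ℝ) * p.2 < p.1 ∧ p.1 ≤ 1 - ((j : ℝ) - 1) * p.2} := by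
    intro j hj
    ext ⟨x, y⟩
    simp only [transitComp, Set.mem_setOf_eq]
    apply and_congr_right
    intro hp
    rw [hI] at hp
    obtain ⟨h1, h2, h3⟩ := hp
    simp only at h1 h2 h3
    have hy : 0 < y := by linarith
    have hit : ∀ n : ℕ, f^[n] (x, y) ∈ A ↔ x + n * y ≤ 1 := by
      intro n
      rw [hfdef, shear_iter, hAdef]
      simp only [Set.mem_prod, Set.mem_Icc]
      have : 0 ≤ (n : ℝ) * y := by positivity
      constructor
      · rintro ⟨⟨_, h⟩, _⟩; exact h
      · intro h; exact ⟨⟨by linarith, h⟩, hy.le, h3⟩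
    rw [exitTime_eq_iff]
    simp only [hit]
    constructor
    · rintro ⟨⟨_, h4⟩, h5⟩
      refine ⟨by linarith, ?_⟩
      rcases Nat.lt_or_ge 1 j with hj1 | hj1
      · have := h5 (j - 1) (by omega) (by omega)
        rw [Nat.cast_sub hj] at this
        push_cast at this
        linarith
      · have : j = 1 := by omega
        subst this
        simp; linarith
    · rintro ⟨h4, h5⟩
      refine ⟨⟨hj, by linarith⟩, fun n _ hn => ?_⟩
      have : (n : ℝ) + 1 ≤ j := by exact_mod_cast hn
      nlinarith
  have hIt : entrySet f A = tri 1 0 := by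
    rw [hI]; simp [tri]
  have hVI : volume (entrySet f A) = ENNReal.ofReal (1 / 2) := by
    rw [hIt, vol_tri 1 0 (by norm_num) (by norm_num)]; norm_num
  have hdiff : ∀ a b c d : ℝ, 0 ≤ a → 0 ≤ b → 0 ≤ c → 0 ≤ d → tri c d ⊆ tri a b →
      volume (tri a b \ tri c d)
        = ENNReal.ofReal (a ^ 2 / (2 * (1 + b)) - c ^ 2 / (2 * (1 + d))) := by
    intro a b c d ha hb hc hd hsub
    rw [measure_diff hsub (meas_tri c d).nullMeasurableSet
      (by rw [vol_tri c d hc hd]; exact ENNReal.ofReal_ne_top),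
      vol_tri a b ha hb, vol_tri c d hc hd, ENNReal.ofReal_sub _ (by positivity)]
  have hV1 : volume (transitComp f A 1) = ENNReal.ofReal (1 / 4) := by
    have : transitComp f A 1 = tri 1 0 \ tri 1 1 := by
      rw [hT 1 le_rfl, hI]
      ext ⟨x, y⟩
      simp only [tri, Set.mem_diff, Set.mem_setOf_eq]
      push_cast
      constructor
      · rintro ⟨⟨h1, h2, h3⟩, h4, h5⟩
        refine ⟨⟨h1, h2, by linarith⟩, fun h => by linarith [h.2.2]⟩
      · rintro ⟨⟨h1, h2, h3⟩, h4⟩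
        refine ⟨⟨h1, h2, by linarith⟩, ?_, by linarith⟩
        by_contra hc
        exact h4 ⟨h1, h2, by linarith⟩
    rw [this, hdiff 1 0 1 1 (by norm_num) (by norm_num) (by norm_num) (by norm_num)]
    · norm_num
    · rintro ⟨x, y⟩ ⟨h1, h2, h3⟩
      simp only at h1 h2 h3
      exact ⟨h1, h2, by simp only; linarith⟩
  have hVj : ∀ j : ℕ, 2 ≤ j →
      volume (transitComp f A j)
        = ENNReal.ofReal (1 / ((j : ℝ) * ((j : ℝ) ^ 2 - 1))) := by
    intro j hj
    obtain ⟨k, rfl⟩ : ∃ k, j = k + 2 := ⟨j - 2, by omega⟩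
    have key : ∀ c x y : ℝ, 0 < c → (y ≤ 1 / c - 1 / c * x ↔ x + c * y ≤ 1) := by
      intro c x y hc
      have : 1 / c - 1 / c * x = (1 - x) / c := by ring
      rw [this, le_div_iff₀ hc]
      constructor <;> intro h <;> linarith
    have hk : (0 : ℝ) ≤ k := Nat.cast_nonneg k
    have hk1 : (0 : ℝ) < (k : ℝ) + 1 := by positivity
    have hk2 : (0 : ℝ) < (k : ℝ) + 2 := by positivity
    have : transitComp f A (k + 2) = tri (1 / ((k : ℝ) + 1)) (1 / ((k : ℝ) + 1))
        \ tri (1 / ((k : ℝ) + 2)) (1 / ((k : ℝ) + 2)) := by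
      rw [hT (k + 2) (by omega), hI]
      ext ⟨x, y⟩
      simp only [tri, Set.mem_diff, Set.mem_setOf_eq, key _ x y hk1, key _ x y hk2]
      push_cast
      constructor
      · rintro ⟨⟨h1, h2, h3⟩, h4, h5⟩
        refine ⟨⟨h1, h2, by linarith⟩, fun h => by linarith [h.2.2]⟩
      · rintro ⟨⟨h1, h2, h3⟩, h4⟩
        refine ⟨⟨h1, h2, by nlinarith⟩, ?_, by linarith⟩
        by_contra hc
        exact h4 ⟨h1, h2, by linarith⟩
    rw [this, hdiff _ _ _ _ (by positivity) (by positivity) (by positivity) (by positivity)]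
    · congr 1
      push_cast
      have e : ((k : ℝ) + 2) * (((k : ℝ) + 2) ^ 2 - 1) = (k + 2) * (k + 1) * (k + 3) := by ring
      rw [e]
      have e1 : (1 : ℝ) + 1 / ((k : ℝ) + 1) = (k + 2) / (k + 1) := by field_simp; ring
      have e2 : (1 : ℝ) + 1 / ((k : ℝ) + 2) = (k + 3) / (k + 2) := by field_simp; ring
      rw [e1, e2]
      field_simp
      ring
    · rintro ⟨x, y⟩ ⟨h1, h2, h3⟩
      simp only [key _ x y hk2] at h1 h2 h3
      refine ⟨h1, h2, ?_⟩
      simp only [key _ x y hk1]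
      nlinarith
  have hVv : ∀ j : ℕ, volume (transitComp f A (j + 1)) = ENNReal.ofReal (vv j) := by
    intro j
    cases j with
    | zero => simpa [vv] using hV1
    | succ k =>
      rw [hVj (k + 1 + 1) (by omega)]
      simp [vv]
  have hAcc : volume (accSet g A) = 1 := by
    have : accSet g A = Set.Icc (0 : ℝ) 1 ×ˢ Set.Ioc (0 : ℝ) 1 := by
      ext ⟨x, y⟩
      simp only [accSet, Set.mem_setOf_eq, exitTime_ne_top_iff]
      rw [hgdef, hAdef]
      simp only [shear_iter_inv, Set.mem_prod, Set.mem_Icc, Set.mem_Ioc]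
      constructor
      · rintro ⟨⟨⟨h1, h2⟩, h3, h4⟩, n, hn, h5⟩
        refine ⟨⟨h1, h2⟩, ?_, h4⟩
        rcases h3.lt_or_eq with h | h
        · exact h
        · exfalso
          apply h5
          rw [← h]
          simp [h1, h2]
      · rintro ⟨⟨h1, h2⟩, h3, h4⟩
        refine ⟨⟨⟨h1, h2⟩, h3.le, h4⟩, ?_⟩
        obtain ⟨n, hn⟩ := exists_nat_gt (x / y)
        rw [div_lt_iff₀ h3] at hn
        refine ⟨n + 1, by omega, fun h => ?_⟩
        have := h.1.1
        push_cast at this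
        nlinarith
    rw [this, Measure.volume_eq_prod, Measure.prod_prod, Real.volume_Icc, Real.volume_Ioc]
    simp
  refine ⟨hI, hT, hV1, hVj, ?_, hVI, ?_, ?_⟩
  · simp_rw [hVv]
    rw [hVI, ← ENNReal.ofReal_tsum_of_nonneg vv_nonneg vv_sum0.summable, vv_sum0.tsum_eq]
  · have : ∀ j : ℕ, ((j + 1 : ℕ) : ℝ≥0∞) * volume (transitComp f A (j + 1))
        = ENNReal.ofReal (((j : ℝ) + 1) * vv j) := by
      intro j
      rw [hVv, ENNReal.ofReal_mul (by positivity), ← ENNReal.ofReal_natCast]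
      push_cast
      rfl
    simp_rw [this]
    rw [hAcc, ← ENNReal.ofReal_tsum_of_nonneg
      (fun j => mul_nonneg (by positivity) (vv_nonneg j)) vv_sum1.summable, vv_sum1.tsum_eq]
    simp
  · by_contra hne
    have hs := ENNReal.summable_toReal hne
    apply vv_sum2
    refine hs.congr (fun j => ?_)
    rw [hVv, ENNReal.toReal_mul, ENNReal.toReal_ofReal (vv_nonneg j), ENNReal.toReal_natCast]
    push_cast
    ring
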